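/- For every integer n > 2 there is no injective group homomorphism from T_2 into T_n. -/

import Mathlib

noncomputable section

namespace ThompsonPaper

/-- The circle `ℝ/ℤ`. -/
abbrev Circle : Type := AddCircle (1 : ℝ)

/-- Homeomorphisms of a topological space form a group under composition,
with `(f * g) x = f (g x)`. -/
instance homeoGroup {α : Type*} [TopologicalSpace α] : Group (α ≃ₜ α) where
  mul f g := g.trans f
  one := Homeomorph.refl α
  inv := Homeomorph.symm
  mul_assoc _ _ _ := Homeomorph.ext fun _ => rfl
  one_mul _ := Homeomorph.ext fun _ => rfl
  mul_one _ := Homeomorph.ext fun _ => rfl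
  inv_mul_cancel f := Homeomorph.ext fun x => f.symm_apply_apply x

/-- `x` is an `n`-adic rational: `x = a / n ^ k` with `a` an integer, `k` a natural number. -/
def IsNAdic (n : ℕ) (x : ℝ) : Prop := ∃ a : ℤ, ∃ k : ℕ, x = (a : ℝ) / (n : ℝ) ^ k

/-- The set of `n`-adic points of the circle. -/
def nAdicPoints (n : ℕ) : Set Circle := { p | ∃ x : ℝ, IsNAdic n x ∧ p = (x : Circle) }

/-- `F : ℝ → ℝ` is a lift of the circle map `f`. -/
def IsLift (f : Circle ≃ₜ Circle) (F : ℝ → ℝ) : Prop :=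
  ∀ x : ℝ, f (x : Circle) = ((F x : ℝ) : Circle)

/-- `F : ℝ → ℝ` commutes with translation by `1` and is piecewise affine with finitely
many breakpoints (modulo `1`), all breakpoints at `n`-adic rationals, and with the slope
of every affine piece an integer power of `n`. -/
def PiecewiseNAffine (n : ℕ) (F : ℝ → ℝ) : Prop :=
  (∀ x : ℝ, F (x + 1) = F x + 1) ∧
  ∃ m : ℕ, ∃ t : ℕ → ℝ, ∃ slope : ℕ → ℤ, ∃ c : ℕ → ℝ,
    0 < m ∧ t 0 = 0 ∧ t m = 1 ∧
    (∀ i, i < m → t i < t (i + 1)) ∧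
    (∀ i, i ≤ m → IsNAdic n (t i)) ∧
    (∀ i, i < m → ∀ x ∈ Set.Icc (t i) (t (i + 1)),
      F x = (n : ℝ) ^ (slope i) * x + c i)

/-- Membership in Thompson's group `T_n`: an orientation-preserving homeomorphism of the
circle `ℝ/ℤ` mapping the set of `n`-adic points onto itself, which is piecewise affine
with finitely many breakpoints, all breakpoints at `n`-adic points, and all slopes integer
powers of `n`.  (Orientation preservation and the piecewise affine structure are expressed
through a strictly increasing lift.) -/
def InT (n : ℕ) (f : Circle ≃ₜ Circle) : Prop :=
  f '' nAdicPoints n = nAdicPoints n ∧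
  ∃ F : ℝ → ℝ, StrictMono F ∧ IsLift f F ∧ PiecewiseNAffine n F

/-- Thompson's group `T_n`, as a set of circle homeomorphisms. -/
def TnSet (n : ℕ) : Set (Circle ≃ₜ Circle) := { f | InT n f }

/-- Thompson's group `T_n`, as a subgroup of the homeomorphism group of the circle.
(The set `TnSet n` is closed under the group operations, so this subgroup has exactly
`TnSet n` as its underlying set.) -/
def Tn (n : ℕ) : Subgroup (Circle ≃ₜ Circle) := Subgroup.closure (TnSet n)

/-! ### n-adic rationals -/

theorem nadic_int (n : ℕ) (a : ℤ) : IsNAdic n (a : ℝ) := ⟨a, 0, by simp⟩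

theorem nadic_add {n : ℕ} (hn : 0 < n) {x y : ℝ} (hx : IsNAdic n x) (hy : IsNAdic n y) :
    IsNAdic n (x + y) := by
  obtain ⟨a, k, rfl⟩ := hx
  obtain ⟨b, l, rfl⟩ := hy
  have : (n : ℝ) ≠ 0 := by positivity
  refine ⟨a * n ^ l + b * n ^ k, k + l, ?_⟩
  push_cast
  rw [pow_add]
  field_simp

theorem nadic_neg {n : ℕ} {x : ℝ} (hx : IsNAdic n x) : IsNAdic n (-x) := by
  obtain ⟨a, k, rfl⟩ := hx
  exact ⟨-a, k, by push_cast; ring⟩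

theorem nadic_sub {n : ℕ} (hn : 0 < n) {x y : ℝ} (hx : IsNAdic n x) (hy : IsNAdic n y) :
    IsNAdic n (x - y) := by
  rw [sub_eq_add_neg]; exact nadic_add hn hx (nadic_neg hy)

theorem nadic_mul {n : ℕ} (hn : 0 < n) {x y : ℝ} (hx : IsNAdic n x) (hy : IsNAdic n y) :
    IsNAdic n (x * y) := by
  obtain ⟨a, k, rfl⟩ := hx
  obtain ⟨b, l, rfl⟩ := hy
  have : (n : ℝ) ≠ 0 := by positivity
  refine ⟨a * b, k + l, ?_⟩
  push_cast
  rw [pow_add]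
  field_simp

theorem nadic_inv_pow (n : ℕ) (k : ℕ) : IsNAdic n (((n : ℝ) ^ k)⁻¹) := ⟨1, k, by simp⟩

theorem nadic_zpow {n : ℕ} (s : ℤ) : IsNAdic n ((n : ℝ) ^ s) := by
  obtain ⟨k, rfl | rfl⟩ := s.eq_nat_or_neg
  · exact ⟨n ^ k, 0, by simp⟩
  · exact ⟨1, k, by simp⟩

/-- The ideal generated by `n - 1` in the n-adic rationals. -/
def NI (n : ℕ) (x : ℝ) : Prop := ∃ y, IsNAdic n y ∧ x = ((n : ℝ) - 1) * y

theorem NI_zero (n : ℕ) : NI n 0 := ⟨0, by simpa using nadic_int n 0, by simp⟩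

theorem NI_add {n : ℕ} (hn : 0 < n) {x y : ℝ} (hx : NI n x) (hy : NI n y) : NI n (x + y) := by
  obtain ⟨a, ha, rfl⟩ := hx
  obtain ⟨b, hb, rfl⟩ := hy
  exact ⟨a + b, nadic_add hn ha hb, by ring⟩

theorem NI_neg {n : ℕ} {x : ℝ} (hx : NI n x) : NI n (-x) := by
  obtain ⟨a, ha, rfl⟩ := hx
  exact ⟨-a, nadic_neg ha, by ring⟩

theorem NI_sub {n : ℕ} (hn : 0 < n) {x y : ℝ} (hx : NI n x) (hy : NI n y) : NI n (x - y) := by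
  rw [sub_eq_add_neg]; exact NI_add hn hx (NI_neg hy)

theorem NI_pow {n : ℕ} (hn : 0 < n) (k : ℕ) {x : ℝ} (hx : IsNAdic n x) :
    NI n ((n : ℝ) ^ k * x - x) := by
  induction k with
  | zero => simpa using NI_zero n
  | succ k ih =>
    have h : NI n ((n : ℝ) ^ (k + 1) * x - (n : ℝ) ^ k * x) := by
      refine ⟨(n : ℝ) ^ k * x, nadic_mul hn ?_ hx, by ring⟩
      simpa using nadic_zpow (n := n) (k : ℤ)
    have := NI_add hn h ih
    convert this using 1
    ring

theorem NI_zpow {n : ℕ} (hn : 0 < n) (s : ℤ) {x : ℝ} (hx : IsNAdic n x) :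
    NI n ((n : ℝ) ^ s * x - x) := by
  obtain ⟨k, rfl | rfl⟩ := s.eq_nat_or_neg
  · simpa using NI_pow hn k hx
  · have h := NI_neg (NI_pow hn k (nadic_mul hn (nadic_zpow (n := n) (-(k : ℤ))) hx))
    have h0 : (n : ℝ) ≠ 0 := by positivity
    convert h using 1
    rw [← mul_assoc, zpow_neg, zpow_natCast, mul_inv_cancel₀ (by positivity)]
    ring

theorem NI_int {n : ℕ} (hn : 2 < n) {p : ℤ} (h : NI n (p : ℝ)) : ((n : ℤ) - 1) ∣ p := by
  obtain ⟨y, ⟨a, k, rfl⟩, h⟩ := h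
  have h0 : (n : ℝ) ≠ 0 := by positivity
  have h1 : p * (n : ℤ) ^ k = ((n : ℤ) - 1) * a := by
    have : (p : ℝ) * (n : ℝ) ^ k = ((n : ℝ) - 1) * a := by
      rw [h]; field_simp
    exact_mod_cast this
  have hc : IsCoprime ((n : ℤ) - 1) ((n : ℤ) ^ k) := by
    apply IsCoprime.pow_right
    exact ⟨-1, 1, by ring⟩
  exact hc.dvd_of_dvd_mul_right ⟨a, h1⟩

/-! ### circle -/

theorem coe_eq_iff (x y : ℝ) : (x : Circle) = (y : Circle) ↔ ∃ k : ℤ, y = x + k := by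
  rw [eq_comm, QuotientAddGroup.eq_iff_sub_mem, AddSubgroup.mem_zmultiples_iff]
  constructor
  · rintro ⟨k, hk⟩
    exact ⟨k, by simp at hk; linarith⟩
  · rintro ⟨k, hk⟩
    exact ⟨k, by simp; linarith⟩

theorem map_add_int (F : ℝ → ℝ) (hF : ∀ x, F (x + 1) = F x + 1) (x : ℝ) (k : ℤ) :
    F (x + k) = F x + k := by
  induction k using Int.induction_on with
  | zero => simp
  | succ i ih =>
    push_cast at *
    rw [← add_assoc, hF, ih]; ring
  | pred i ih =>
    push_cast at *
    have := hF (x + (-(i : ℝ) - 1))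
    rw [show x + (-(i : ℝ) - 1) + 1 = x + -(i : ℝ) by ring, ih] at this
    linarith

theorem mem_nAdicPoints {n : ℕ} (hn : 0 < n) (x : ℝ) :
    (x : Circle) ∈ nAdicPoints n ↔ IsNAdic n x := by
  constructor
  · rintro ⟨y, hy, h⟩
    obtain ⟨k, rfl⟩ := (coe_eq_iff _ _).1 h
    have := nadic_sub hn hy (nadic_int n k)
    simpa using this
  · intro h
    exact ⟨x, h, rfl⟩

/-- The properties of elements of `T_n` used in the obstruction. -/
structure Good (n : ℕ) (f : Circle ≃ₜ Circle) (F : ℝ ≃o ℝ) : Prop where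
  lift : IsLift f F
  per : ∀ x, F (x + 1) = F x + 1
  nad : ∀ x, IsNAdic n (F x) ↔ IsNAdic n x
  coc : ∀ x, IsNAdic n x → NI n (F x - x - F 0)

theorem good_of_InT {n : ℕ} (hn : 0 < n) {f : Circle ≃ₜ Circle} (h : InT n f) :
    ∃ F, Good n f F := by
  obtain ⟨him, F, hmono, hlift, hper, m, t, s, c, hm, ht0, htm, htlt, htn, hF⟩ := h
  have hsurj : Function.Surjective F := by
    intro y
    obtain ⟨p, hp⟩ := f.surjective (y : Circle)
    obtain ⟨x, rfl⟩ := QuotientAddGroup.mk_surjective p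
    have h2 : ((F x : ℝ) : Circle) = (y : Circle) := (hlift x).symm.trans hp
    obtain ⟨k, hk⟩ := (coe_eq_iff _ _).1 h2
    exact ⟨x + k, by rw [map_add_int F hper, hk]⟩
  have hnad : ∀ x, IsNAdic n (F x) ↔ IsNAdic n x := by
    intro x
    rw [← mem_nAdicPoints hn, ← mem_nAdicPoints hn, ← hlift x]
    constructor
    · intro h
      rw [← him] at h
      obtain ⟨p, hp, hpx⟩ := h
      rwa [← f.injective hpx]
    · intro h
      rw [← him]
      exact ⟨_, h, rfl⟩
  have key : ∀ i, i ≤ m → ∀ x, 0 ≤ x → x ≤ t i → IsNAdic n x → NI n (F x - x - F 0) := by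
    intro i
    induction i with
    | zero =>
      intro _ x hx0 hx1 _
      have : x = 0 := by linarith
      subst this
      simpa using NI_zero n
    | succ i ih =>
      intro hi x hx0 hx1 hxn
      by_cases hx : x ≤ t i
      · exact ih (by omega) x hx0 hx hxn
      · have ht0' : ∀ j, j ≤ m → 0 ≤ t j := by
          intro j
          induction j with
          | zero => intro _; exact ht0.ge
          | succ j ihj => intro hj; exact (ihj (by omega)).trans (htlt j (by omega)).le
        have h1 := ih (by omega) (t i) (ht0' i (by omega)) le_rfl (htn i (by omega))
        have e1 := hF i (by omega) x ⟨(not_le.1 hx).le, hx1⟩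
        have e2 := hF i (by omega) (t i) ⟨le_rfl, (htlt i (by omega)).le⟩
        have h2 := NI_zpow hn (s i) (nadic_sub hn hxn (htn i (by omega)))
        have h3 := NI_add hn h1 h2
        convert h3 using 1
        rw [e1, e2]
        ring
  refine ⟨hmono.orderIsoOfSurjective F hsurj, ⟨hlift, hper, hnad, ?_⟩⟩
  intro x hx
  simp only [StrictMono.coe_orderIsoOfSurjective]
  have h := key m le_rfl (Int.fract x) (Int.fract_nonneg x)
    (by rw [htm]; exact (Int.fract_lt_one x).le)
    (nadic_sub hn hx (nadic_int n _))
  convert h using 1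
  have := map_add_int F hper (Int.fract x) ⌊x⌋
  rw [Int.fract_add_floor] at this
  rw [this]
  have := Int.fract_add_floor x
  linarith

theorem good_one (n : ℕ) : Good n 1 (OrderIso.refl ℝ) where
  lift _ := rfl
  per _ := rfl
  nad _ := Iff.rfl
  coc x _ := by simpa using NI_zero n

theorem good_mul {n : ℕ} (hn : 0 < n) {f g : Circle ≃ₜ Circle} {F G : ℝ ≃o ℝ}
    (hf : Good n f F) (hg : Good n g G) : Good n (f * g) (G.trans F) where
  lift x := by
    change f (g x) = _
    rw [hg.lift, hf.lift]; rfl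
  per x := by simp [hg.per, hf.per]
  nad x := by simp [hg.nad, hf.nad]
  coc x hx := by
    have h1 := hf.coc (G x) ((hg.nad x).2 hx)
    have h2 := hg.coc x hx
    have h3 := hf.coc (G 0) ((hg.nad 0).2 (by simpa using nadic_int n 0))
    convert NI_sub hn (NI_add hn h1 h2) h3 using 1
    simp only [OrderIso.trans_apply]
    ring

theorem good_inv {n : ℕ} (hn : 0 < n) {f : Circle ≃ₜ Circle} {F : ℝ ≃o ℝ}
    (hf : Good n f F) : Good n f⁻¹ F.symm where
  lift x := by
    apply f.injective
    change f (f.symm x) = _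
    rw [hf.lift, f.apply_symm_apply, F.apply_symm_apply]
  per x := by
    apply F.injective
    simp [hf.per]
  nad x := by rw [← hf.nad]; simp
  coc x hx := by
    have h1 := hf.coc (F.symm x) (by rw [← hf.nad]; simpa using hx)
    have h2 := hf.coc (F.symm 0) (by rw [← hf.nad]; simpa using nadic_int n 0)
    convert NI_sub hn h2 h1 using 1
    simp only [OrderIso.apply_symm_apply]
    ring

theorem good_of_mem {n : ℕ} (hn : 0 < n) {f : Circle ≃ₜ Circle} (h : f ∈ Tn n) :
    ∃ F, Good n f F := by
  induction h using Subgroup.closure_induction with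
  | mem f hf => exact good_of_InT hn hf
  | one => exact ⟨_, good_one n⟩
  | mul f g _ _ hf hg =>
    obtain ⟨F, hF⟩ := hf
    obtain ⟨G, hG⟩ := hg
    exact ⟨_, good_mul hn hF hG⟩
  | inv f _ hf =>
    obtain ⟨F, hF⟩ := hf
    exact ⟨_, good_inv hn hF⟩

theorem lift_pow {f : Circle ≃ₜ Circle} {F : ℝ → ℝ} (h : IsLift f F) (k : ℕ) :
    IsLift (f ^ k) (F^[k]) := by
  induction k with
  | zero => intro x; rfl
  | succ k ih =>
    intro x
    rw [pow_succ', Function.iterate_succ_apply']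
    change f ((f ^ k) x) = _
    rw [ih, h]

theorem iterate_per {F : ℝ → ℝ} (h : ∀ x, F (x + 1) = F x + 1) (k : ℕ) :
    ∀ x, F^[k] (x + 1) = F^[k] x + 1 := by
  induction k with
  | zero => intro x; rfl
  | succ k ih =>
    intro x
    rw [Function.iterate_succ_apply', Function.iterate_succ_apply', ih, h]

/-- `T_n` has no nontrivial element with `f ^ (n-1) = 1`. -/
theorem no_torsion {n : ℕ} (hn : 2 < n) {f : Circle ≃ₜ Circle} (h : f ∈ Tn n)
    (hq : f ^ (n - 1) = 1) : f = 1 := by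
  have hn0 : 0 < n := by omega
  obtain ⟨F, hF⟩ := good_of_mem hn0 h
  have hnq : ((n - 1 : ℕ) : ℝ) = (n : ℝ) - 1 := by
    rw [Nat.cast_sub (by omega)]; simp
  have hzero : IsNAdic n 0 := by simpa using nadic_int n 0
  have hit : ∀ k : ℕ, IsNAdic n (F^[k] 0) ∧ NI n (F^[k] 0 - k * F 0) := by
    intro k
    induction k with
    | zero => exact ⟨hzero, by simpa using NI_zero n⟩
    | succ k ih =>
      rw [Function.iterate_succ_apply']
      refine ⟨(hF.nad _).2 ih.1, ?_⟩
      convert NI_add hn0 ih.2 (hF.coc _ ih.1) using 1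
      push_cast
      ring
  have hpx : ∀ x : ℝ, ∃ p : ℤ, F^[n - 1] x = x + p := by
    intro x
    have := lift_pow hF.lift (n - 1) x
    rw [hq] at this
    exact (coe_eq_iff _ _).1 this
  obtain ⟨p, hp⟩ := hpx 0
  rw [zero_add] at hp
  have hNp : NI n (p : ℝ) := by
    have h1 := (hit (n - 1)).2
    rw [hp, hnq] at h1
    have h2 : NI n (((n : ℝ) - 1) * F 0) := ⟨F 0, (hF.nad 0).2 hzero, rfl⟩
    simpa using NI_add hn0 h1 h2
  obtain ⟨r, hr⟩ := NI_int hn hNp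
  have hmono : StrictMono (F^[n - 1]) := F.strictMono.iterate _
  have hconst : ∀ x : ℝ, 0 ≤ x → x < 1 → F^[n - 1] x = x + p := by
    intro x hx0 hx1
    obtain ⟨p', hp'⟩ := hpx x
    have h1 := hmono.monotone hx0
    have h2 := hmono hx1
    have h3 := iterate_per hF.per (n - 1) 0
    rw [zero_add, hp] at h3
    rw [hp, hp'] at h1
    rw [hp', h3] at h2
    have a1 : p < p' + 1 := by
      have : (p : ℝ) < p' + 1 := by linarith
      exact_mod_cast this
    have a2 : p' < p + 1 := by
      have : (p' : ℝ) < p + 1 := by linarith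
      exact_mod_cast this
    rw [hp', show p' = p by omega]
  have hcomm : Function.Commute F (fun y => y + (r : ℝ)) := fun y => map_add_int F hF.per y r
  have hfix : ∀ x : ℝ, 0 ≤ x → x < 1 → F x = x + r := by
    intro x hx0 hx1
    have hs : StrictMono (fun y : ℝ => y + (r : ℝ)) := fun a b hab => by
      simp only; linarith
    refine (hcomm.iterate_pos_eq_iff_map_eq F.monotone hs (n := n - 1) (by omega)).1 ?_
    rw [hconst x hx0 hx1, hr, add_right_iterate_apply, nsmul_eq_mul, hnq]
    push_cast
    ring
  ext z
  obtain ⟨x, rfl⟩ := QuotientAddGroup.mk_surjective z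
  have e : ((Int.fract x : ℝ) : Circle) = (x : Circle) :=
    (coe_eq_iff _ _).2 ⟨⌊x⌋, (Int.fract_add_floor x).symm⟩
  change f (x : Circle) = (x : Circle)
  rw [← e, hF.lift, hfix _ (Int.fract_nonneg x) (Int.fract_lt_one x)]
  exact ((coe_eq_iff _ _).2 ⟨r, rfl⟩).symm

/-! ### torsion in `T_2` -/

/-- The circle homeomorphism induced by a periodic order isomorphism of the line. -/
def circMap (F : ℝ → ℝ) (h : ∀ x, F (x + 1) = F x + 1) : Circle → Circle :=
  Quotient.lift (s := QuotientAddGroup.leftRel _) (fun x : ℝ => ((F x : ℝ) : Circle)) (by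
    intro a b hab
    have : (a : Circle) = (b : Circle) := Quotient.sound hab
    obtain ⟨k, rfl⟩ := (coe_eq_iff _ _).1 this
    exact (coe_eq_iff _ _).2 ⟨k, map_add_int F h a k⟩)

theorem circMap_coe (F : ℝ → ℝ) (h : ∀ x, F (x + 1) = F x + 1) (x : ℝ) :
    circMap F h (x : Circle) = ((F x : ℝ) : Circle) := rfl

theorem circMap_cont (F : ℝ → ℝ) (h : ∀ x, F (x + 1) = F x + 1) (hc : Continuous F) :
    Continuous (circMap F h) :=
  Continuous.quotient_lift ((AddCircle.continuous_mk' (1 : ℝ)).comp hc) _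

theorem symm_per (F : ℝ ≃o ℝ) (h : ∀ x, F (x + 1) = F x + 1) (x : ℝ) :
    F.symm (x + 1) = F.symm x + 1 := by
  apply F.injective
  simp [h]

def circHomeo (F : ℝ ≃o ℝ) (h : ∀ x, F (x + 1) = F x + 1) : Circle ≃ₜ Circle where
  toFun := circMap F h
  invFun := circMap F.symm (symm_per F h)
  left_inv z := by
    obtain ⟨x, rfl⟩ := QuotientAddGroup.mk_surjective z
    change circMap F.symm _ (circMap F h (x : Circle)) = (x : Circle)
    rw [circMap_coe, circMap_coe, F.symm_apply_apply]
  right_inv z := by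
    obtain ⟨x, rfl⟩ := QuotientAddGroup.mk_surjective z
    change circMap F h (circMap F.symm _ (x : Circle)) = (x : Circle)
    rw [circMap_coe, circMap_coe, F.apply_symm_apply]
  continuous_toFun := circMap_cont _ _ F.continuous
  continuous_invFun := circMap_cont _ _ F.symm.continuous

/-- The basic convex piecewise linear map. -/
def gg (k : ℕ) (x : ℝ) : ℝ :=
  max ((x + 1) / 2) (max (x + ((2 : ℝ) ^ (k + 1))⁻¹) (2 ^ k * (x - 1) + 3 / 2))

def FF (k : ℕ) (x : ℝ) : ℝ := ⌊x⌋ + gg k (Int.fract x)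

theorem gg_mono (k : ℕ) : StrictMono (gg k) := by
  intro x y h
  have hk : (0 : ℝ) < 2 ^ k := by positivity
  have := mul_lt_mul_of_pos_left (sub_lt_sub_right h 1) hk
  unfold gg
  refine max_lt_max (by linarith) (max_lt_max (by linarith) (by linarith))

theorem gg_cont (k : ℕ) : Continuous (gg k) := by
  unfold gg
  fun_prop

theorem inv_pow_le (k : ℕ) (hk : 2 ≤ k) : ((2 : ℝ) ^ k)⁻¹ ≤ 1 / 4 := by
  have hb : (4 : ℝ) ≤ 2 ^ k := by
    calc (4 : ℝ) = 2 ^ 2 := by norm_num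
      _ ≤ 2 ^ k := pow_le_pow_right₀ (by norm_num) hk
  rw [← one_div]
  exact one_div_le_one_div_of_le (by norm_num) hb

/-- first piece -/
theorem gg_first (k : ℕ) (hk : 2 ≤ k) (x : ℝ) (h : x ≤ 1 - ((2 : ℝ) ^ k)⁻¹) :
    gg k x = (x + 1) / 2 := by
  have hb : (4 : ℝ) ≤ 2 ^ k := by
    calc (4 : ℝ) = 2 ^ 2 := by norm_num
      _ ≤ 2 ^ k := pow_le_pow_right₀ (by norm_num) hk
  unfold gg
  rw [pow_succ]
  set b : ℝ := 2 ^ k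
  have hb0 : b ≠ 0 := by linarith
  have h1 : (b * 2)⁻¹ = b⁻¹ / 2 := by field_simp
  have h2 : b * b⁻¹ = 1 := by field_simp
  rw [h1]
  have h3 := inv_pow_le k hk
  change b⁻¹ ≤ 1 / 4 at h3
  refine max_eq_left (max_le (by linarith) ?_)
  nlinarith [mul_nonneg (show 0 ≤ b - 1 / 2 by linarith) (show 0 ≤ 1 - x - b⁻¹ by linarith)]

theorem gg_second (k : ℕ) (hk : 2 ≤ k) (x : ℝ) (h : 1 - ((2 : ℝ) ^ k)⁻¹ ≤ x)
    (h' : x ≤ 1 - ((2 : ℝ) ^ (k + 1))⁻¹) :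
    gg k x = x + ((2 : ℝ) ^ (k + 1))⁻¹ := by
  have hb : (4 : ℝ) ≤ 2 ^ k := by
    calc (4 : ℝ) = 2 ^ 2 := by norm_num
      _ ≤ 2 ^ k := pow_le_pow_right₀ (by norm_num) hk
  unfold gg
  rw [pow_succ] at *
  set b : ℝ := 2 ^ k
  have hb0 : b ≠ 0 := by linarith
  have h1 : (b * 2)⁻¹ = b⁻¹ / 2 := by field_simp
  have h2 : b * b⁻¹ = 1 := by field_simp
  rw [h1] at h' ⊢
  rw [max_eq_left (a := x + b⁻¹ / 2), max_eq_right]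
  · linarith
  · nlinarith [mul_nonneg (show 0 ≤ b - 1 by linarith) (show 0 ≤ 1 - x - b⁻¹ / 2 by linarith)]

theorem gg_third (k : ℕ) (hk : 2 ≤ k) (x : ℝ) (h : 1 - ((2 : ℝ) ^ (k + 1))⁻¹ ≤ x) :
    gg k x = 2 ^ k * (x - 1) + 3 / 2 := by
  have hb : (4 : ℝ) ≤ 2 ^ k := by
    calc (4 : ℝ) = 2 ^ 2 := by norm_num
      _ ≤ 2 ^ k := pow_le_pow_right₀ (by norm_num) hk
  unfold gg
  rw [pow_succ] at *
  set b : ℝ := 2 ^ k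
  have hb0 : b ≠ 0 := by linarith
  have h1 : (b * 2)⁻¹ = b⁻¹ / 2 := by field_simp
  have h2 : b * b⁻¹ = 1 := by field_simp
  have h3 : 0 < b⁻¹ := by positivity
  rw [h1] at h ⊢
  rw [max_eq_right (b := max _ _), max_eq_right]
  · nlinarith [mul_nonneg (show 0 ≤ b - 1 by linarith) (show 0 ≤ x - 1 + b⁻¹ / 2 by linarith)]
  · refine le_max_of_le_right ?_
    nlinarith [mul_nonneg (show 0 ≤ b - 1 / 2 by linarith)
      (show 0 ≤ x - 1 + b⁻¹ / 2 by linarith)]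

theorem gg_zero (k : ℕ) (hk : 2 ≤ k) : gg k 0 = 1 / 2 := by
  rw [gg_first k hk]
  · norm_num
  · have := inv_pow_le k hk; linarith

theorem gg_one (k : ℕ) (hk : 2 ≤ k) : gg k 1 = 3 / 2 := by
  rw [gg_third k hk]
  · norm_num
  · have : (0 : ℝ) < ((2 : ℝ) ^ (k + 1))⁻¹ := by positivity
    linarith

theorem FF_per (k : ℕ) (x : ℝ) : FF k (x + 1) = FF k x + 1 := by
  unfold FF
  simp
  ring

theorem FF_eq (k : ℕ) (x : ℝ) (h0 : 0 ≤ x) (h1 : x < 1) : FF k x = gg k x := by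
  unfold FF
  rw [Int.fract_eq_self.2 ⟨h0, h1⟩, Int.floor_eq_zero_iff.2 ⟨h0, h1⟩]
  simp

theorem FF_eq' (k : ℕ) (hk : 2 ≤ k) (x : ℝ) (h0 : 0 ≤ x) (h1 : x ≤ 1) : FF k x = gg k x := by
  rcases h1.lt_or_eq with h | rfl
  · exact FF_eq k x h0 h
  · have := FF_per k 0
    rw [zero_add, FF_eq k 0 le_rfl one_pos, gg_zero k hk] at this
    rw [this, gg_one k hk]; norm_num

theorem FF_mono (k : ℕ) (hk : 2 ≤ k) : StrictMono (FF k) := by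
  intro x y h
  unfold FF
  have hx := Int.fract_add_floor x
  have hy := Int.fract_add_floor y
  rcases (Int.floor_mono h.le).lt_or_eq with hf | hf
  · have h1 := gg_mono k (Int.fract_lt_one x)
    have h2 := (gg_mono k).monotone (Int.fract_nonneg y)
    rw [gg_one k hk] at h1
    rw [gg_zero k hk] at h2
    have : (⌊x⌋ : ℝ) + 1 ≤ ⌊y⌋ := by exact_mod_cast hf
    linarith
  · rw [hf] at hx ⊢
    have := gg_mono k (show Int.fract x < Int.fract y by linarith)
    linarith

theorem FF_surj (k : ℕ) (hk : 2 ≤ k) : Function.Surjective (FF k) := by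
  intro y
  have h := intermediate_value_Icc (zero_le_one' ℝ) (gg_cont k).continuousOn
  rw [gg_zero k hk, gg_one k hk] at h
  have hs : Int.fract (y - 1 / 2) + 1 / 2 ∈ Set.Icc (1 / 2 : ℝ) (3 / 2) := by
    have h1 := Int.fract_nonneg (y - 1 / 2)
    have h2 := Int.fract_lt_one (y - 1 / 2)
    constructor <;> linarith
  obtain ⟨r, ⟨hr0, hr1⟩, hr⟩ := h hs
  refine ⟨r + ⌊y - 1 / 2⌋, ?_⟩
  rw [map_add_int _ (FF_per k), FF_eq' k hk r hr0 hr1, hr]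
  have := Int.fract_add_floor (y - 1 / 2)
  linarith

def FI (k : ℕ) (hk : 2 ≤ k) : ℝ ≃o ℝ := (FF_mono k hk).orderIsoOfSurjective _ (FF_surj k hk)

theorem FI_apply (k : ℕ) (hk : 2 ≤ k) (x : ℝ) : FI k hk x = FF k x := rfl

/-- The torsion element. -/
def tor (k : ℕ) (hk : 2 ≤ k) : Circle ≃ₜ Circle := circHomeo (FI k hk) (FF_per k)

theorem tor_lift (k : ℕ) (hk : 2 ≤ k) : IsLift (tor k hk) (FF k) := fun _ => rfl

theorem two_nadic (s : ℤ) : IsNAdic 2 ((2 : ℝ) ^ s) := by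
  have := nadic_zpow (n := 2) s
  simpa using this

theorem two_nadic_inv (k : ℕ) : IsNAdic 2 (((2 : ℝ) ^ k)⁻¹) := by
  have := nadic_inv_pow 2 k
  simpa using this

theorem gg_nad (k : ℕ) (x : ℝ) : IsNAdic 2 (gg k x) ↔ IsNAdic 2 x := by
  have z2 : (0 : ℕ) < 2 := by norm_num
  have half : IsNAdic 2 (1 / 2 : ℝ) := by simpa using two_nadic (-1)
  have one : IsNAdic 2 (1 : ℝ) := by simpa using nadic_int 2 1
  have two : IsNAdic 2 (2 : ℝ) := by simpa using nadic_int 2 2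
  have th : IsNAdic 2 (3 / 2 : ℝ) := by
    convert nadic_add z2 one half using 1; norm_num
  have a1 : IsNAdic 2 ((x + 1) / 2) ↔ IsNAdic 2 x := by
    constructor
    · intro h
      convert nadic_sub z2 (nadic_mul z2 two h) one using 1; ring
    · intro h
      convert nadic_mul z2 half (nadic_add z2 h one) using 1; ring
  have a2 : IsNAdic 2 (x + ((2 : ℝ) ^ (k + 1))⁻¹) ↔ IsNAdic 2 x := by
    constructor
    · intro h
      convert nadic_sub z2 h (two_nadic_inv (k + 1)) using 1; ring
    · intro h
      exact nadic_add z2 h (two_nadic_inv (k + 1))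
  have a3 : IsNAdic 2 (2 ^ k * (x - 1) + 3 / 2) ↔ IsNAdic 2 x := by
    constructor
    · intro h
      convert nadic_add z2 (nadic_mul z2 (two_nadic_inv k) (nadic_sub z2 h th)) one using 1
      field_simp
      ring
    · intro h
      refine nadic_add z2 (nadic_mul z2 ?_ (nadic_sub z2 h one)) th
      simpa using two_nadic k
  unfold gg
  rcases max_choice ((x + 1) / 2) (max (x + ((2 : ℝ) ^ (k + 1))⁻¹) (2 ^ k * (x - 1) + 3 / 2))
    with h | h
  · rw [h, a1]
  · rw [h]
    rcases max_choice (x + ((2 : ℝ) ^ (k + 1))⁻¹) (2 ^ k * (x - 1) + 3 / 2) with h | h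
    · rw [h, a2]
    · rw [h, a3]

theorem nad_add_int (n : ℕ) (hn : 0 < n) (x : ℝ) (a : ℤ) :
    IsNAdic n (a + x) ↔ IsNAdic n x := by
  constructor
  · intro h
    simpa using nadic_sub hn h (nadic_int n a)
  · intro h
    exact nadic_add hn (nadic_int n a) h

theorem FF_nad (k : ℕ) (x : ℝ) : IsNAdic 2 (FF k x) ↔ IsNAdic 2 x := by
  unfold FF
  rw [nad_add_int 2 (by norm_num), gg_nad, ← nad_add_int 2 (by norm_num) _ ⌊x⌋,
    Int.floor_add_fract]

theorem tor_InT (k : ℕ) (hk : 2 ≤ k) : InT 2 (tor k hk) := by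
  have z2 : (0 : ℕ) < 2 := by norm_num
  refine ⟨?_, FF k, FF_mono k hk, tor_lift k hk, FF_per k, ?_⟩
  · ext p
    constructor
    · rintro ⟨_, ⟨x, hx, rfl⟩, rfl⟩
      exact ⟨FF k x, (FF_nad k x).2 hx, rfl⟩
    · rintro ⟨y, hy, rfl⟩
      obtain ⟨x, rfl⟩ := FF_surj k hk y
      exact ⟨x, ⟨x, (FF_nad k x).1 hy, rfl⟩, rfl⟩
  · have one : IsNAdic 2 (1 : ℝ) := by simpa using nadic_int 2 1
    have zero : IsNAdic 2 (0 : ℝ) := by simpa using nadic_int 2 0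
    have i1 := inv_pow_le k hk
    have i2 : ((2 : ℝ) ^ (k + 1))⁻¹ = ((2 : ℝ) ^ k)⁻¹ / 2 := by
      rw [pow_succ]; field_simp
    have i3 : 0 < ((2 : ℝ) ^ k)⁻¹ := by positivity
    refine ⟨3, fun i => if i = 0 then 0 else if i = 1 then 1 - ((2 : ℝ) ^ k)⁻¹ else
      if i = 2 then 1 - ((2 : ℝ) ^ (k + 1))⁻¹ else 1,
      fun i => if i = 0 then -1 else if i = 1 then 0 else k,
      fun i => if i = 0 then 1 / 2 else if i = 1 then ((2 : ℝ) ^ (k + 1))⁻¹ else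
        3 / 2 - 2 ^ k, by norm_num, by simp, by simp, ?_, ?_, ?_⟩
    · intro i hi
      interval_cases i
      · norm_num; linarith
      · norm_num; linarith
      · norm_num
    · intro i hi
      interval_cases i
      · simpa using zero
      · simpa using nadic_sub z2 one (two_nadic_inv k)
      · simpa using nadic_sub z2 one (two_nadic_inv (k + 1))
      · simpa using one
    · intro i hi x hx
      interval_cases i
      · norm_num at hx ⊢
        rw [FF_eq' k hk x (by linarith) (by linarith), gg_first k hk x (by linarith)]
        ring
      · simp at hx ⊢
        rw [FF_eq' k hk x (by linarith) (by linarith), gg_second k hk x (by linarith)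
          (by linarith)]
      · simp at hx ⊢
        rw [FF_eq' k hk x (by linarith) (by linarith), gg_third k hk x (by linarith)]
        ring

theorem iter_first (k : ℕ) (hk : 2 ≤ k) (x : ℝ) (h0 : 0 ≤ x) (h1 : x ≤ 1 / 2) (j : ℕ)
    (hj : j ≤ k) : (FF k)^[j] x = 1 - ((2 : ℝ) ^ j)⁻¹ * (1 - x) := by
  induction j with
  | zero => simp
  | succ j ih =>
    rw [Function.iterate_succ_apply', ih (by omega)]
    have e : ((2 : ℝ) ^ (j + 1))⁻¹ = ((2 : ℝ) ^ j)⁻¹ / 2 := by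
      rw [pow_succ]; field_simp
    have p : 0 < ((2 : ℝ) ^ j)⁻¹ := by positivity
    have p1 : ((2 : ℝ) ^ j)⁻¹ ≤ 1 := inv_le_one_of_one_le₀ (one_le_pow₀ (by norm_num))
    have le : ((2 : ℝ) ^ k)⁻¹ ≤ ((2 : ℝ) ^ (j + 1))⁻¹ :=
      inv_anti₀ (by positivity) (pow_le_pow_right₀ (by norm_num) hj)
    rw [FF_eq' k hk _ (by nlinarith) (by nlinarith), gg_first k hk _ (by nlinarith), e]
    ring

theorem iter_base (k : ℕ) (hk : 2 ≤ k) (x : ℝ) (h0 : 0 ≤ x) (h1 : x ≤ 1 / 2) :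
    (FF k)^[k + 2] x = x + 1 := by
  rw [Function.iterate_succ_apply', Function.iterate_succ_apply',
    iter_first k hk x h0 h1 k le_rfl]
  have i1 := inv_pow_le k hk
  have i2 : ((2 : ℝ) ^ (k + 1))⁻¹ = ((2 : ℝ) ^ k)⁻¹ / 2 := by
    rw [pow_succ]; field_simp
  have i3 : 0 < ((2 : ℝ) ^ k)⁻¹ := by positivity
  have i4 : (2 : ℝ) ^ k * ((2 : ℝ) ^ k)⁻¹ = 1 := by field_simp
  rw [FF_eq' k hk (1 - _) (by nlinarith) (by nlinarith), gg_second k hk _ (by nlinarith)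
    (by rw [i2]; nlinarith), i2]
  rw [FF_eq' k hk _ (by nlinarith) (by nlinarith), gg_third k hk _ (by rw [i2]; nlinarith)]
  linear_combination (-1 / 2 + x) * i4

theorem iter_all (k : ℕ) (hk : 2 ≤ k) (j : ℕ) : ∀ x : ℝ, 0 ≤ x → x < (FF k)^[j] 0 →
    (FF k)^[k + 2] x = x + 1 := by
  have h00 : FF k 0 = 1 / 2 := by rw [FF_eq k 0 le_rfl one_pos, gg_zero k hk]
  induction j with
  | zero => intro x h0 h1; simp at h1; linarith
  | succ j ih =>
    intro x h0 h1
    by_cases hx : x ≤ 1 / 2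
    · exact iter_base k hk x h0 hx
    · obtain ⟨y, rfl⟩ := FF_surj k hk x
      rw [Function.iterate_succ_apply'] at h1
      have hy1 := (FF_mono k hk).lt_iff_lt.1 h1
      have hy0 : 0 ≤ y := by
        apply (FF_mono k hk).le_iff_le.1
        rw [h00]; linarith
      rw [← Function.iterate_succ_apply, Function.iterate_succ_apply', ih y hy0 hy1, FF_per]

theorem tor_pow (k : ℕ) (hk : 2 ≤ k) : (tor k hk) ^ (k + 2) = 1 := by
  ext z
  obtain ⟨x, rfl⟩ := QuotientAddGroup.mk_surjective z
  have e : ((Int.fract x : ℝ) : Circle) = (x : Circle) :=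
    (coe_eq_iff _ _).2 ⟨⌊x⌋, (Int.fract_add_floor x).symm⟩
  change (tor k hk ^ (k + 2)) (x : Circle) = (x : Circle)
  rw [← e, lift_pow (tor_lift k hk), iter_all k hk (k + 2) _ (Int.fract_nonneg x)]
  · exact ((coe_eq_iff _ _).2 ⟨1, by simp⟩).symm
  · rw [iter_base k hk 0 le_rfl (by norm_num)]
    simpa using Int.fract_lt_one x

theorem tor_sq_ne (k : ℕ) (hk : 2 ≤ k) : (tor k hk) ^ 2 ≠ 1 := by
  intro h
  have h1 := lift_pow (tor_lift k hk) 2 0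
  rw [h, iter_first k hk 0 le_rfl (by norm_num) 2 hk] at h1
  obtain ⟨a, ha⟩ := (coe_eq_iff _ _).1 h1
  have h4 : (3 : ℝ) = 4 * a := by norm_num at ha; linarith
  have : (3 : ℤ) = 4 * a := by exact_mod_cast h4
  omega

/-- For every integer `n > 2` there is no injective group homomorphism
from `T_2` into `T_n`. -/
theorem no_injective_hom_T2_to_Tn (n : ℕ) (hn : 2 < n) :
    ∀ φ : Tn 2 →* Tn n, ¬ Function.Injective φ := by
  intro φ hφ
  have hk : 2 ≤ 2 * (n - 1) - 2 := by omega
  have hmem : tor _ hk ^ 2 ∈ Tn 2 :=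
    (Tn 2).pow_mem (Subgroup.subset_closure (show tor _ hk ∈ TnSet 2 from tor_InT _ hk)) 2
  have hpow : (tor _ hk ^ 2) ^ (n - 1) = 1 := by
    rw [← pow_mul]
    have := tor_pow _ hk
    rwa [show 2 * (n - 1) - 2 + 2 = 2 * (n - 1) by omega] at this
  let g : Tn 2 := ⟨tor _ hk ^ 2, hmem⟩
  have hgp : g ^ (n - 1) = 1 := Subtype.ext hpow
  have h1 : (φ g) ^ (n - 1) = 1 := by rw [← map_pow, hgp, map_one]
  have h2 : φ g = 1 :=
    Subtype.ext (no_torsion hn (φ g).2 (congrArg (fun z : Tn n => (z : Circle ≃ₜ Circle)) h1))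
  have h3 : g = 1 := hφ (by rw [h2, map_one])
  exact tor_sq_ne _ hk (congrArg (fun z : Tn 2 => (z : Circle ≃ₜ Circle)) h3)

end ThompsonPaper
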